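/- arXiv:2012.05062 — 3 statements merged into one kernel-verified Lean document; each statement's English description precedes it below -/
import Mathlib

section
/- Let p : [0,1] → ℝ be continuously differentiable with p(x) > 0 for all x ∈ [0,1], let q : [0,1] → ℝ be continuous, and let q_c ∈ ℝ. Let f : [0,1] → ℝ be twice continuously differentiable and satisfy the ordinary differential equation (p·f′)′(x) + (q_c − q(x))·f(x) = 0 for all x ∈ [0,1]. If there exists x0 ∈ [0,1] with f(x0) = 0 and f′(x0) = 0, then f(x) = 0 for all x ∈ [0,1]. -/
/-- A solution of the planar linear system `g' = α w`, `w' = β g` with continuous coefficients on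
a compact interval vanishes identically as soon as it vanishes at one point. -/
theorem eqOn_zero_of_hasDerivWithinAt_planar_system {a b t₀ : ℝ} {α β g w : ℝ → ℝ}
    (hα : ContinuousOn α (Set.Icc a b)) (hβ : ContinuousOn β (Set.Icc a b))
    (hg : ∀ t ∈ Set.Icc a b, HasDerivWithinAt g (α t * w t) (Set.Icc a b) t)
    (hw : ∀ t ∈ Set.Icc a b, HasDerivWithinAt w (β t * g t) (Set.Icc a b) t)
    (ht₀ : t₀ ∈ Set.Icc a b) (hg₀ : g t₀ = 0) (hw₀ : w t₀ = 0) :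
    Set.EqOn (fun t => (g t, w t)) 0 (Set.Icc a b) := by
  obtain ⟨A, hA⟩ := isCompact_Icc.exists_bound_of_continuousOn hα
  obtain ⟨B, hB⟩ := isCompact_Icc.exists_bound_of_continuousOn hβ
  let v : ℝ → ℝ × ℝ → ℝ × ℝ := fun t y => (α t * y.2, β t * y.1)
  have hv : ∀ t ∈ Set.Icc a b, LipschitzOnWith (max A B).toNNReal (v t) Set.univ := by
    intro t ht
    refine LipschitzOnWith.of_dist_le_mul fun x _ y _ => ?_
    have hAB : |α t| ≤ max A B ∧ |β t| ≤ max A B :=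
      ⟨(hA t ht).trans (le_max_left _ _), (hB t ht).trans (le_max_right _ _)⟩
    have hM : 0 ≤ max A B := (abs_nonneg _).trans hAB.1
    rw [Real.coe_toNNReal _ hM, Prod.dist_eq, Prod.dist_eq]
    simp only [v, Real.dist_eq, ← mul_sub, abs_mul]
    exact max_le (mul_le_mul hAB.1 (le_max_right _ _) (abs_nonneg _) hM)
      (mul_le_mul hAB.2 (le_max_left _ _) (abs_nonneg _) hM)
  have hu : ∀ t ∈ Set.Icc a b,
      HasDerivWithinAt (fun t => (g t, w t)) (v t (g t, w t)) (Set.Icc a b) t :=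
    fun t ht => (hg t ht).prodMk (hw t ht)
  have huc : ContinuousOn (fun t => (g t, w t)) (Set.Icc a b) :=
    fun t ht => (hu t ht).continuousWithinAt
  have hzero : ∀ (s : Set ℝ) (t : ℝ),
      HasDerivWithinAt (0 : ℝ → ℝ × ℝ) (v t ((0 : ℝ → ℝ × ℝ) t)) s t := by
    intro s t
    have hvt : v t ((0 : ℝ → ℝ × ℝ) t) = 0 := by simp [v]
    rw [hvt]
    exact hasDerivWithinAt_const t s (0 : ℝ × ℝ)
  have h₀ : (fun t => (g t, w t)) t₀ = (0 : ℝ → ℝ × ℝ) t₀ := by simp [hg₀, hw₀]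
  have hleft : Set.Icc a t₀ ⊆ Set.Icc a b := Set.Icc_subset_Icc_right ht₀.2
  have hright : Set.Icc t₀ b ⊆ Set.Icc a b := Set.Icc_subset_Icc_left ht₀.1
  rw [← Set.Icc_union_Icc_eq_Icc ht₀.1 ht₀.2]
  refine Set.EqOn.union ?_ ?_
  · refine ODE_solution_unique_of_mem_Icc_left (v := v) (s := fun _ => Set.univ)
      (fun t ht => hv t (hleft (Set.Ioc_subset_Icc_self ht))) (huc.mono hleft) ?_
      (fun _ _ => trivial) continuousOn_const (fun t _ => hzero _ t) (fun _ _ => trivial) h₀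
    intro t ht
    have ht' := hleft (Set.Ioc_subset_Icc_self ht)
    exact (hu t ht').mono_of_mem_nhdsWithin
      (Filter.mem_of_superset (Icc_mem_nhdsLE ht.1) (Set.Icc_subset_Icc_right ht'.2))
  · refine ODE_solution_unique_of_mem_Icc_right (v := v) (s := fun _ => Set.univ)
      (fun t ht => hv t (hright (Set.Ico_subset_Icc_self ht))) (huc.mono hright) ?_
      (fun _ _ => trivial) continuousOn_const (fun t _ => hzero _ t) (fun _ _ => trivial) h₀
    intro t ht
    have ht' := hright (Set.Ico_subset_Icc_self ht)
    exact (hu t ht').mono_of_mem_nhdsWithin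
      (Filter.mem_of_superset (Icc_mem_nhdsGE ht.2) (Set.Icc_subset_Icc_left ht'.1))

/-- Cauchy uniqueness for the Sturm–Liouville equation
`(p f′)′ + (q_c − q) f = 0` on `[0,1]`: if `p` is `C¹` and positive, `q` is continuous,
`f` is `C²` and solves the ODE, and `f(x0) = f′(x0) = 0` at some `x0 ∈ [0,1]`, then `f ≡ 0`
on `[0,1]`. Derivatives are taken within `[0,1]`. -/
theorem stmt4 (p q f : ℝ → ℝ) (qc : ℝ)
    (hp : ContDiffOn ℝ 1 p (Set.Icc 0 1))
    (hppos : ∀ x ∈ Set.Icc (0 : ℝ) 1, 0 < p x)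
    (hq : ContinuousOn q (Set.Icc 0 1))
    (hf : ContDiffOn ℝ 2 f (Set.Icc 0 1))
    (hode : ∀ x ∈ Set.Icc (0 : ℝ) 1,
      derivWithin (fun y => p y * derivWithin f (Set.Icc 0 1) y) (Set.Icc 0 1) x
        + (qc - q x) * f x = 0)
    (x0 : ℝ) (hx0 : x0 ∈ Set.Icc (0 : ℝ) 1)
    (hfx0 : f x0 = 0) (hfx0' : derivWithin f (Set.Icc 0 1) x0 = 0) :
    ∀ x ∈ Set.Icc (0 : ℝ) 1, f x = 0 := by
  have hdiff : UniqueDiffOn ℝ (Set.Icc (0 : ℝ) 1) := uniqueDiffOn_Icc zero_lt_one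
  have hf' : ContDiffOn ℝ 1 (derivWithin f (Set.Icc 0 1)) (Set.Icc 0 1) :=
    hf.derivWithin hdiff (by norm_num)
  have hpf' : DifferentiableOn ℝ (fun y => p y * derivWithin f (Set.Icc 0 1) y) (Set.Icc 0 1) :=
    (hp.mul hf').differentiableOn one_ne_zero
  have hzero := eqOn_zero_of_hasDerivWithinAt_planar_system
    (α := fun t => (p t)⁻¹) (β := fun t => q t - qc) (g := f)
    (w := fun y => p y * derivWithin f (Set.Icc 0 1) y)
    (hp.continuousOn.inv₀ fun t ht => (hppos t ht).ne') (hq.sub continuousOn_const)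
    (fun t ht => by
      rw [inv_mul_cancel_left₀ (hppos t ht).ne']
      exact (hf.differentiableOn two_ne_zero t ht).hasDerivWithinAt)
    (fun t ht => by
      have hderiv : (q t - qc) * f t =
          derivWithin (fun y => p y * derivWithin f (Set.Icc 0 1) y) (Set.Icc 0 1) t := by
        linear_combination -hode t ht
      rw [hderiv]
      exact (hpf' t ht).hasDerivWithinAt)
    hx0 hfx0 (by simp [hfx0'])
  exact fun x hx => congrArg Prod.fst (hzero hx)
end

section
/- Let δ > 0, c ≥ 0, and η ∈ [0,1). Let V : [0,∞) → ℝ be differentiable with V(t) ≥ 0 for all t ≥ 0, and let r : [0,∞) → ℝ be continuous. Assume that V′(t) + 2δ·V(t) ≤ c·r(t)² for all t ≥ 0. Then, with M1 := c/(2δ(1−η)), for all t ≥ 0 one has V(t) ≤ e^{−2δ t}·V(0) + M1·sup_{τ ∈ [0,t]} e^{−2ηδ(t−τ)}·r(τ)². -/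
/-- comparison estimate. If `V ≥ 0` is differentiable on `[0,∞)` with
`V′(t) + 2δ V(t) ≤ c r(t)²`, then with `M1 = c/(2δ(1-η))`,
`V(t) ≤ e^{−2δt} V(0) + M1 · sup_{τ∈[0,t]} e^{−2ηδ(t−τ)} r(τ)²`. -/
theorem stmt6 (δ c η : ℝ) (hδ : 0 < δ) (hc : 0 ≤ c) (hη : 0 ≤ η ∧ η < 1)
    (V V' r : ℝ → ℝ)
    (hV : ∀ t : ℝ, 0 ≤ t → HasDerivWithinAt V (V' t) (Set.Ici 0) t)
    (hVpos : ∀ t : ℝ, 0 ≤ t → 0 ≤ V t)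
    (hr : ContinuousOn r (Set.Ici 0))
    (hineq : ∀ t : ℝ, 0 ≤ t → V' t + 2 * δ * V t ≤ c * r t ^ 2) :
    ∀ t : ℝ, 0 ≤ t →
      V t ≤ Real.exp (-(2 * δ * t)) * V 0 +
        c / (2 * δ * (1 - η)) *
          sSup ((fun τ => Real.exp (-(2 * η * δ * (t - τ))) * r τ ^ 2) '' Set.Icc 0 t) := by
  intro t ht
  set S := sSup ((fun τ => Real.exp (-(2 * η * δ * (t - τ))) * r τ ^ 2) '' Set.Icc 0 t)
  set M := c / (2 * δ * (1 - η))
  have hη' : 0 < 1 - η := sub_pos.mpr hη.2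
  have hM0 : 0 ≤ M := by positivity
  have hMc : M * (2 * δ * (1 - η)) = c := div_mul_cancel₀ _ (by positivity)
  have hcont : ContinuousOn (fun τ => Real.exp (-(2 * η * δ * (t - τ))) * r τ ^ 2)
      (Set.Icc 0 t) :=
    (Continuous.continuousOn (by fun_prop)).mul ((hr.mono Set.Icc_subset_Ici_self).pow 2)
  have hle : ∀ s ∈ Set.Icc 0 t, Real.exp (-(2 * η * δ * (t - s))) * r s ^ 2 ≤ S := fun s hs =>
    le_csSup (isCompact_Icc.image_of_continuousOn hcont).bddAbove (Set.mem_image_of_mem _ hs)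
  have hS0 : 0 ≤ S := le_trans (by positivity) (hle t ⟨ht, le_rfl⟩)
  -- The derivative inequality makes `W` nonincreasing on `[0, t]`.
  let W : ℝ → ℝ := fun s =>
    Real.exp (2 * δ * s) * V s - M * S * Real.exp (2 * η * δ * t + 2 * δ * (1 - η) * s)
  have hW : ∀ s, 0 ≤ s → HasDerivWithinAt W
      (Real.exp (2 * δ * s) * (V' s + 2 * δ * V s) -
        c * S * Real.exp (2 * η * δ * t + 2 * δ * (1 - η) * s)) (Set.Ici 0) s := by
    intro s hs
    have h₁ : HasDerivAt (fun s : ℝ => Real.exp (2 * δ * s))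
        (Real.exp (2 * δ * s) * (2 * δ * 1)) s := ((hasDerivAt_id s).const_mul (2 * δ)).exp
    have h₂ : HasDerivAt (fun s : ℝ => Real.exp (2 * η * δ * t + 2 * δ * (1 - η) * s))
        (Real.exp (2 * η * δ * t + 2 * δ * (1 - η) * s) * (2 * δ * (1 - η) * 1)) s :=
      (((hasDerivAt_id s).const_mul (2 * δ * (1 - η))).const_add (2 * η * δ * t)).exp
    refine ((h₁.hasDerivWithinAt.mul (hV s hs)).sub
      (h₂.const_mul (M * S)).hasDerivWithinAt).congr_deriv ?_
    rw [← hMc]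
    ring
  have hanti : AntitoneOn W (Set.Icc 0 t) := by
    refine antitoneOn_of_hasDerivWithinAt_nonpos (convex_Icc 0 t)
      (fun s hs => (hW s hs.1).continuousWithinAt.mono Set.Icc_subset_Ici_self)
      (fun s hs => (hW s (interior_subset hs).1).mono
        (interior_subset.trans Set.Icc_subset_Ici_self)) fun s hs => ?_
    have hs' := interior_subset hs
    have hexp : Real.exp (2 * δ * s) = Real.exp (2 * η * δ * t + 2 * δ * (1 - η) * s) *
        Real.exp (-(2 * η * δ * (t - s))) := by
      rw [← Real.exp_add]
      ring_nf
    rw [sub_nonpos]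
    calc Real.exp (2 * δ * s) * (V' s + 2 * δ * V s)
        ≤ Real.exp (2 * δ * s) * (c * r s ^ 2) := by gcongr; exact hineq s hs'.1
      _ = c * (Real.exp (-(2 * η * δ * (t - s))) * r s ^ 2) *
          Real.exp (2 * η * δ * t + 2 * δ * (1 - η) * s) := by rw [hexp]; ring
      _ ≤ c * S * Real.exp (2 * η * δ * t + 2 * δ * (1 - η) * s) := by
        gcongr; exact hle s hs'
  have hW0 : W 0 ≤ V 0 := by
    have : 0 ≤ M * S * Real.exp (2 * η * δ * t) := by positivity
    simpa [W] using this
  have hWt : W t = Real.exp (2 * δ * t) * (V t - M * S) := by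
    have : 2 * η * δ * t + 2 * δ * (1 - η) * t = 2 * δ * t := by ring
    simp only [W, this]
    ring
  have hfin : Real.exp (2 * δ * t) * (V t - M * S) ≤ V 0 :=
    hWt ▸ (hanti ⟨le_rfl, ht⟩ ⟨ht, le_rfl⟩ ht).trans hW0
  rw [← sub_le_iff_le_add, Real.exp_neg, inv_mul_eq_div, le_div_iff₀ (Real.exp_pos _), mul_comm]
  exact hfin
end

section
/- Let q_c, δ ∈ ℝ with δ > 0, M ≥ 0, and c > 0, and let (λ_n)_{n≥1} be a real sequence with λ_n ≥ c·(n−1)² for all n ≥ 1. Then there exists an integer N1 ≥ 1 such that for every integer N ≥ N1 and every integer n ≥ N+1, one has −λ_n + q_c + δ + λ_n/√N + (M/2)·N^{3/2} ≤ 0. -/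
/-- feasibility of the modal decay conditions with `α = β = √N`, `γ = 1/N`.
Given `δ > 0`, `M ≥ 0`, `c > 0` and `λ_n ≥ c(n-1)²`, there is `N1 ≥ 1` such that for all
`N ≥ N1` and all `n ≥ N+1`:
`-λ_n + q_c + δ + λ_n/√N + (M/2)·N^{3/2} ≤ 0`. -/
theorem stmt11 (qc δ M c : ℝ) (hδ : 0 < δ) (hM : 0 ≤ M) (hc : 0 < c)
    (lam : ℕ → ℝ) (hlam : ∀ n : ℕ, 1 ≤ n → c * ((n : ℝ) - 1) ^ 2 ≤ lam n) :
    ∃ N1 : ℕ, 1 ≤ N1 ∧ ∀ N : ℕ, N1 ≤ N → ∀ n : ℕ, N + 1 ≤ n →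
      -lam n + qc + δ + lam n / Real.sqrt (N : ℝ) + (M / 2) * (N : ℝ) ^ ((3 : ℝ) / 2) ≤ 0 := by
  set t : ℝ := 2 + (2 * |qc + δ| + M) / c with ht
  have ht2 : 2 ≤ t := le_add_of_nonneg_right (by positivity)
  have hct : 2 * |qc + δ| + M ≤ c * t := by
    have h : c * t = 2 * c + (2 * |qc + δ| + M) := by rw [ht]; field_simp
    linarith
  refine ⟨⌈t ^ 2⌉₊ + 1, Nat.le_add_left _ _, fun N hN n hn => ?_⟩
  have htN : t ^ 2 ≤ (N : ℝ) :=
    (Nat.le_ceil _).trans (by exact_mod_cast (Nat.le_succ _).trans hN)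
  have hts : t ≤ √(N : ℝ) := Real.le_sqrt_of_sq_le htN
  have hsq : √(N : ℝ) ^ 2 = N := Real.sq_sqrt N.cast_nonneg
  have hpow : (N : ℝ) ^ ((3 : ℝ) / 2) = √(N : ℝ) ^ 3 := by
    rw [Real.sqrt_eq_rpow, ← Real.rpow_mul_natCast N.cast_nonneg]
    norm_num
  rw [hpow]
  generalize √(N : ℝ) = s at hts hsq ⊢
  have hs2 : 2 ≤ s := ht2.trans hts
  have hlam_ge : c * s ^ 4 ≤ lam n := by
    have hnN : (N : ℝ) ≤ (n : ℝ) - 1 := by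
      have : (N : ℝ) + 1 ≤ n := by exact_mod_cast hn
      linarith
    calc c * s ^ 4 = c * (N : ℝ) ^ 2 := by rw [← hsq]; ring
      _ ≤ c * ((n : ℝ) - 1) ^ 2 := by gcongr
      _ ≤ lam n := hlam n (by omega)
  have hlam_nonneg : 0 ≤ lam n := le_trans (by positivity) hlam_ge
  have hdiv : lam n / s ≤ lam n / 2 := by gcongr
  have hgrowth : (2 * |qc + δ| + M) * s ^ 3 ≤ c * s ^ 4 :=
    calc (2 * |qc + δ| + M) * s ^ 3 ≤ (c * s) * s ^ 3 := by
          gcongr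
          exact hct.trans (by gcongr)
      _ = c * s ^ 4 := by ring
  have habs : |qc + δ| ≤ |qc + δ| * s ^ 3 :=
    le_mul_of_one_le_right (abs_nonneg _) (one_le_pow₀ (by linarith))
  linarith [le_abs_self (qc + δ)]
end
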